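/- Let d ≥ 2, β ≥ 2, and λ₀ ≥ max{ 2, √(2/(3(d−1))) · 2d/(12 √(d−1) β) + 2/(3(d−1)) }. Define ω(V) := √(λ_max(V)) / (12 √(d−1) β) for real symmetric positive semidefinite d×d matrices V. Let θ ∈ S^{d-1}, let (θ̂_t)_{t≥0} be any sequence of nonzero vectors in ℝ^d, and set c_t := θ̂_t/‖θ̂_t‖₂. Define V₀ := λ₀ I and, for each t ≥ 0, pick an orthonormal basis v_{t,1}, …, v_{t,d} of eigenvectors of V_t with eigenvalues in nondecreasing order, set a±_{t+1,i} equal to the normalization of c_t ± (1/√(λ_min(V_t))) v_{t,i} for i = 1, …, d−1, and let V_{t+1} := V_t + ω(V_t) Σ_{i=1}^{d−1} ( a⁺_{t+1,i}(a⁺_{t+1,i})ᵀ + a⁻_{t+1,i}(a⁻_{t+1,i})ᵀ ). If ⟨θ − θ̂_t, V_t(θ − θ̂_t)⟩ ≤ β for every t ≥ 0, then for every t ≥ 1 and every i ∈ {1, …, d−1}, ‖θ − a±_{t+1,i}‖₂² ≤ (144 d β² + 24 √(d−1) β) / t. -/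

import Mathlib

open Matrix

/-- The normalization `u / ‖u‖₂` of a vector `u ∈ ℝ^d`. -/
noncomputable def unitize {d : ℕ} (u : Fin d → ℝ) : Fin d → ℝ :=
  (Real.sqrt (∑ i, u i ^ 2))⁻¹ • u

section Unitize

variable {d : ℕ}

theorem unitize_eq (u : Fin d → ℝ) : unitize u = (√(u ⬝ᵥ u))⁻¹ • u := by
  simp only [unitize, dotProduct, sq]

theorem unitize_dotProduct_self {u : Fin d → ℝ} (hu : 0 < u ⬝ᵥ u) :
    unitize u ⬝ᵥ unitize u = 1 := by
  rw [unitize_eq, smul_dotProduct, dotProduct_smul, smul_eq_mul, smul_eq_mul, ← mul_assoc,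
    ← mul_inv, Real.mul_self_sqrt hu.le, inv_mul_cancel₀ hu.ne']

theorem zero_le_dotProduct_self (u : Fin d → ℝ) : 0 ≤ u ⬝ᵥ u := by
  simpa using dotProduct_star_self_nonneg u

theorem sq_dotProduct_unitize (w u : Fin d → ℝ) :
    (w ⬝ᵥ unitize u) ^ 2 = (w ⬝ᵥ u) ^ 2 / (u ⬝ᵥ u) := by
  rw [unitize_eq, dotProduct_smul, smul_eq_mul, mul_pow, inv_pow,
    Real.sq_sqrt (zero_le_dotProduct_self u), mul_comm,
    div_eq_mul_inv]

theorem dotProduct_self_pos {u : Fin d → ℝ} (hu : u ≠ 0) : 0 < u ⬝ᵥ u := by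
  simpa using Matrix.dotProduct_star_self_pos_iff.mpr hu

theorem sub_dotProduct_self (x y : Fin d → ℝ) :
    (x - y) ⬝ᵥ (x - y) = x ⬝ᵥ x - 2 * (x ⬝ᵥ y) + y ⬝ᵥ y := by
  rw [sub_dotProduct, dotProduct_sub, dotProduct_sub, dotProduct_comm y x]
  ring

theorem sq_dotProduct_le (x y : Fin d → ℝ) : (x ⬝ᵥ y) ^ 2 ≤ (x ⬝ᵥ x) * (y ⬝ᵥ y) := by
  have := Finset.sum_mul_sq_le_sq_mul_sq Finset.univ x y
  simpa only [dotProduct, sq] using this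

/-- Normalizing a vector within distance `1` of a unit vector at most doubles the squared
distance. -/
theorem sub_unitize_dotProduct_self_le {x y : Fin d → ℝ} (hx : x ⬝ᵥ x = 1)
    (hxy : (x - y) ⬝ᵥ (x - y) < 1) :
    (x - unitize y) ⬝ᵥ (x - unitize y) ≤ 2 * ((x - y) ⬝ᵥ (x - y)) := by
  have hy : 0 < y ⬝ᵥ y := by
    apply dotProduct_self_pos
    rintro rfl
    simp [hx] at hxy
  rw [sub_dotProduct_self, hx] at hxy
  rw [sub_dotProduct_self, sub_dotProduct_self, hx, unitize_dotProduct_self hy]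
  have h2 := sq_dotProduct_le x (unitize y)
  rw [hx, unitize_dotProduct_self hy] at h2
  have hn : 0 < √(y ⬝ᵥ y) := Real.sqrt_pos.mpr hy
  have hn2 : √(y ⬝ᵥ y) ^ 2 = y ⬝ᵥ y := Real.sq_sqrt hy.le
  have h3 : x ⬝ᵥ y = √(y ⬝ᵥ y) * (x ⬝ᵥ unitize y) := by
    rw [unitize_eq, dotProduct_smul, smul_eq_mul, mul_inv_cancel_left₀ hn.ne']
  rw [h3] at hxy ⊢
  generalize x ⬝ᵥ unitize y = g at *
  generalize √(y ⬝ᵥ y) = n at *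
  rw [← hn2] at hxy ⊢
  have hg : 0 < g := by
    by_contra! h
    nlinarith
  have hg1 : g ≤ 1 := by nlinarith
  nlinarith [sq_nonneg (n - g), mul_nonneg hg.le (sub_nonneg.mpr hg1)]

theorem sub_dotProduct_self_le_weighted (x y z : Fin d → ℝ) :
    (x - z) ⬝ᵥ (x - z) ≤ 3 / 2 * ((x - y) ⬝ᵥ (x - y)) + 3 * ((y - z) ⬝ᵥ (y - z)) := by
  simp only [dotProduct, Finset.mul_sum, ← Finset.sum_add_distrib]
  refine Finset.sum_le_sum fun i _ => ?_
  simp only [Pi.sub_apply]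
  nlinarith [sq_nonneg ((x i - y i) - 2 * (y i - z i))]

end Unitize

section Probe

variable {d : ℕ} {c v : Fin d → ℝ} {r : ℝ}

theorem add_smul_dotProduct_self (hc : c ⬝ᵥ c = 1) (hv : v ⬝ᵥ v = 1) :
    (c + r • v) ⬝ᵥ (c + r • v) = 1 + 2 * r * (c ⬝ᵥ v) + r ^ 2 := by
  simp only [add_dotProduct, dotProduct_add, smul_dotProduct, dotProduct_smul, smul_eq_mul, hc, hv,
    dotProduct_comm v c]
  ring

theorem probe_norm_pos (hc : c ⬝ᵥ c = 1) (hv : v ⬝ᵥ v = 1) (hr : r ^ 2 ≤ 1 / 2) :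
    0 < (c + r • v) ⬝ᵥ (c + r • v) := by
  have h := sq_dotProduct_le c v
  rw [hc, hv] at h
  rw [add_smul_dotProduct_self hc hv]
  nlinarith [sq_nonneg (3 / 2 * r + c ⬝ᵥ v)]

theorem probe_norm_le (hc : c ⬝ᵥ c = 1) (hv : v ⬝ᵥ v = 1) (hr : r ^ 2 ≤ 1 / 2) :
    (c + r • v) ⬝ᵥ (c + r • v) ≤ 3 := by
  have h := sq_dotProduct_le c v
  rw [hc, hv] at h
  rw [add_smul_dotProduct_self hc hv]
  nlinarith [sq_nonneg (3 / 2 * r - c ⬝ᵥ v)]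

theorem sq_dotProduct_probe_ge (hc : c ⬝ᵥ c = 1) (hv : v ⬝ᵥ v = 1) (hr : r ^ 2 ≤ 1 / 2)
    (w : Fin d → ℝ) :
    (w ⬝ᵥ c + r * (w ⬝ᵥ v)) ^ 2 / 3 ≤ (w ⬝ᵥ unitize (c + r • v)) ^ 2 := by
  rw [sq_dotProduct_unitize, dotProduct_add, dotProduct_smul, smul_eq_mul]
  exact div_le_div_of_nonneg_left (sq_nonneg _) (probe_norm_pos hc hv hr) (probe_norm_le hc hv hr)

theorem sum_sq_dotProduct_probe_ge (hc : c ⬝ᵥ c = 1) (hv : v ⬝ᵥ v = 1) (hr : r ^ 2 ≤ 1 / 2)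
    (w : Fin d → ℝ) :
    2 / 3 * r ^ 2 * (w ⬝ᵥ v) ^ 2 ≤
      (w ⬝ᵥ unitize (c + r • v)) ^ 2 + (w ⬝ᵥ unitize (c - r • v)) ^ 2 := by
  have h1 := sq_dotProduct_probe_ge hc hv hr w
  have h2 := sq_dotProduct_probe_ge (r := -r) hc hv (by simpa using hr) w
  rw [neg_smul, ← sub_eq_add_neg] at h2
  nlinarith [sq_nonneg (w ⬝ᵥ c)]

end Probe

section Eigenbasis

variable {d : ℕ} {V : Matrix (Fin d) (Fin d) ℝ} {μ : Fin d → ℝ} {v : Fin d → Fin d → ℝ}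

theorem of_mul_transpose_of (horth : ∀ i j : Fin d, ∑ k, v i k * v j k = if i = j then 1 else 0) :
    Matrix.of v * (Matrix.of v)ᵀ = 1 := by
  ext i j
  simp [Matrix.mul_apply, horth, Matrix.one_apply]

theorem eq_transpose_mul_diagonal_mul
    (horth : ∀ i j : Fin d, ∑ k, v i k * v j k = if i = j then 1 else 0)
    (heig : ∀ i, V *ᵥ v i = μ i • v i) :
    V = (Matrix.of v)ᵀ * Matrix.diagonal μ * Matrix.of v := by
  have h : V * (Matrix.of v)ᵀ = (Matrix.of v)ᵀ * Matrix.diagonal μ := by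
    ext i j
    have := congrFun (heig j) i
    simp only [Matrix.mulVec, dotProduct, Pi.smul_apply, smul_eq_mul] at this
    simp [Matrix.mul_apply, this, mul_comm, Matrix.diagonal_apply]
  rw [← h, Matrix.mul_assoc, mul_eq_one_comm.mp (of_mul_transpose_of horth), Matrix.mul_one]

theorem trace_eq_sum_eigenvalues
    (horth : ∀ i j : Fin d, ∑ k, v i k * v j k = if i = j then 1 else 0)
    (heig : ∀ i, V *ᵥ v i = μ i • v i) : V.trace = ∑ i, μ i := by
  rw [eq_transpose_mul_diagonal_mul horth heig, Matrix.trace_mul_comm, ← Matrix.mul_assoc,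
    of_mul_transpose_of horth, Matrix.one_mul, Matrix.trace_diagonal]

theorem dotProduct_self_eq_sum_sq
    (horth : ∀ i j : Fin d, ∑ k, v i k * v j k = if i = j then 1 else 0) (u : Fin d → ℝ) :
    u ⬝ᵥ u = ∑ i, (u ⬝ᵥ v i) ^ 2 := by
  have h : u = (Matrix.of v)ᵀ *ᵥ (Matrix.of v *ᵥ u) := by
    rw [Matrix.mulVec_mulVec, mul_eq_one_comm.mp (of_mul_transpose_of horth), Matrix.one_mulVec]
  nth_rewrite 2 [h]
  rw [Matrix.dotProduct_mulVec, Matrix.vecMul_transpose]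
  simp [dotProduct, Matrix.mulVec, sq, mul_comm]

theorem dotProduct_mulVec_eq_sum
    (horth : ∀ i j : Fin d, ∑ k, v i k * v j k = if i = j then 1 else 0)
    (heig : ∀ i, V *ᵥ v i = μ i • v i) (u : Fin d → ℝ) :
    u ⬝ᵥ V *ᵥ u = ∑ i, μ i * (u ⬝ᵥ v i) ^ 2 := by
  rw [eq_transpose_mul_diagonal_mul horth heig, ← Matrix.mulVec_mulVec, ← Matrix.mulVec_mulVec,
    Matrix.dotProduct_mulVec, Matrix.vecMul_transpose]
  simp only [dotProduct, Matrix.mulVec_diagonal]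
  refine Finset.sum_congr rfl fun i _ => ?_
  simp only [Matrix.mulVec, dotProduct, Matrix.of_apply, mul_comm (u _)]
  ring

theorem eigenvalue_eq_dotProduct
    (horth : ∀ i j : Fin d, ∑ k, v i k * v j k = if i = j then 1 else 0)
    (heig : ∀ i, V *ᵥ v i = μ i • v i) (i : Fin d) : μ i = v i ⬝ᵥ V *ᵥ v i := by
  have : v i ⬝ᵥ v i = 1 := by simpa [dotProduct] using horth i i
  rw [heig, dotProduct_smul, this, smul_eq_mul, mul_one]

theorem sum_fin_sub_one_add_last (hlast : d - 1 < d) (hlt : ∀ i : Fin (d - 1), i.1 < d)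
    (f : Fin d → ℝ) :
    ∑ i, f i = ∑ i : Fin (d - 1), f ⟨i.1, hlt i⟩ + f ⟨d - 1, hlast⟩ := by
  obtain _ | n := d
  · omega
  · exact Fin.sum_univ_castSucc f

theorem min_eigenvalue_mul_le
    (horth : ∀ i j : Fin d, ∑ k, v i k * v j k = if i = j then 1 else 0)
    (heig : ∀ i, V *ᵥ v i = μ i • v i) (hmono : Monotone μ) (hpos : 0 < d) (u : Fin d → ℝ) :
    μ ⟨0, hpos⟩ * (u ⬝ᵥ u) ≤ u ⬝ᵥ V *ᵥ u := by
  rw [dotProduct_mulVec_eq_sum horth heig, dotProduct_self_eq_sum_sq horth, Finset.mul_sum]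
  refine Finset.sum_le_sum fun i _ => mul_le_mul_of_nonneg_right (hmono ?_) (sq_nonneg _)
  exact Fin.mk_le_of_le_val (Nat.zero_le _)

theorem le_max_eigenvalue_mul
    (horth : ∀ i j : Fin d, ∑ k, v i k * v j k = if i = j then 1 else 0)
    (heig : ∀ i, V *ᵥ v i = μ i • v i) (hmono : Monotone μ) (hlast : d - 1 < d) (u : Fin d → ℝ) :
    u ⬝ᵥ V *ᵥ u ≤ μ ⟨d - 1, hlast⟩ * (u ⬝ᵥ u) := by
  rw [dotProduct_mulVec_eq_sum horth heig, dotProduct_self_eq_sum_sq horth, Finset.mul_sum]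
  refine Finset.sum_le_sum fun i _ => mul_le_mul_of_nonneg_right (hmono ?_) (sq_nonneg _)
  exact Fin.le_def.mpr (by have := i.2; simp only; omega)

/-- The quadratic form is bounded below by separating the top eigendirection. -/
theorem min_max_eigenvalue_le
    (horth : ∀ i j : Fin d, ∑ k, v i k * v j k = if i = j then 1 else 0)
    (heig : ∀ i, V *ᵥ v i = μ i • v i) (hmono : Monotone μ) (hpos : 0 < d)
    (hlast : d - 1 < d) (hlt : ∀ i : Fin (d - 1), i.1 < d) (u : Fin d → ℝ) :
    μ ⟨0, hpos⟩ *
        ∑ i : Fin (d - 1), (u ⬝ᵥ v ⟨i.1, hlt i⟩) ^ 2 +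
      μ ⟨d - 1, hlast⟩ * (u ⬝ᵥ v ⟨d - 1, hlast⟩) ^ 2 ≤ u ⬝ᵥ V *ᵥ u := by
  rw [dotProduct_mulVec_eq_sum horth heig, sum_fin_sub_one_add_last hlast hlt, Finset.mul_sum]
  gcongr with i
  exact hmono (Fin.mk_le_of_le_val (Nat.zero_le _))

end Eigenbasis

theorem dotProduct_rankOne_update {d : ℕ} {ι : Type*} [Fintype ι] {V V' : Matrix (Fin d) (Fin d) ℝ}
    {ω : ℝ} {a b : ι → Fin d → ℝ}
    (hV : V' = V + ω • ∑ i, (vecMulVec (a i) (a i) + vecMulVec (b i) (b i))) (u : Fin d → ℝ) :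
    u ⬝ᵥ V' *ᵥ u = u ⬝ᵥ V *ᵥ u + ω * ∑ i, ((u ⬝ᵥ a i) ^ 2 + (u ⬝ᵥ b i) ^ 2) := by
  rw [hV, Matrix.add_mulVec, Matrix.smul_mulVec, Matrix.sum_mulVec, dotProduct_add,
    dotProduct_smul, dotProduct_sum, smul_eq_mul]
  congr 2
  refine Finset.sum_congr rfl fun i _ => ?_
  rw [Matrix.add_mulVec, dotProduct_add, Matrix.vecMulVec_mulVec, Matrix.vecMulVec_mulVec]
  simp only [op_smul_eq_smul, dotProduct_smul, smul_eq_mul, dotProduct_comm _ u]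
  ring

theorem trace_rankOne_update {d : ℕ} {ι : Type*} [Fintype ι] {V V' : Matrix (Fin d) (Fin d) ℝ}
    {ω : ℝ} {a b : ι → Fin d → ℝ}
    (hV : V' = V + ω • ∑ i, (vecMulVec (a i) (a i) + vecMulVec (b i) (b i)))
    (ha : ∀ i, a i ⬝ᵥ a i = 1) (hb : ∀ i, b i ⬝ᵥ b i = 1) :
    V'.trace = V.trace + 2 * Fintype.card ι * ω := by
  rw [hV, Matrix.trace_add, Matrix.trace_smul, Matrix.trace_sum]
  simp only [Matrix.trace_add, Matrix.trace_vecMulVec, ha, hb, Finset.sum_const, Finset.card_univ,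
    nsmul_eq_mul, smul_eq_mul]
  ring

/-- Scalar step: the balance `2 Λ ≤ 3 m λ²` between the extreme eigenvalues is preserved. -/
theorem eigenvalue_balance_step {m lam Lam lam' Lam' ω s : ℝ} (hm : 1 ≤ m) (hlam : 2 ≤ lam)
    (hle : lam ≤ Lam) (hω : 0 ≤ ω) (hω' : ω ≤ Lam / 24) (hs : 0 ≤ s) (hs1 : s ≤ 1)
    (hlow : lam * (1 - s) + Lam * s + ω * (2 / 3 * lam⁻¹ * (1 - s)) ≤ lam')
    (hup : Lam' ≤ Lam + 2 * m * ω) (hbal : 2 * Lam ≤ 3 * m * lam ^ 2) :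
    2 ≤ lam' ∧ 2 * Lam' ≤ 3 * m * lam' ^ 2 := by
  obtain ⟨g, hg⟩ : ∃ g, g = ω * (2 / 3 * lam⁻¹) := ⟨_, rfl⟩
  have hg0 : 0 ≤ g := by rw [hg]; positivity
  have hglam : lam * g = 2 / 3 * ω := by rw [hg]; field_simp
  have hlow' : lam + s * (Lam - lam) + g * (1 - s) ≤ lam' := by
    rw [hg]; linarith
  have h1 : 0 ≤ s * (Lam - lam) := mul_nonneg hs (by linarith)
  have h2 : 0 ≤ g * (1 - s) := mul_nonneg hg0 (by linarith)
  refine ⟨by linarith, ?_⟩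
  by_cases hgap : g ≤ Lam - lam
  · have h3 : lam + g ≤ lam' := by nlinarith
    have h4 : lam ^ 2 + 4 / 3 * ω ≤ lam' ^ 2 := by nlinarith
    nlinarith
  · push Not at hgap
    have h3 : lam ≤ lam' := by linarith
    have h4 : g ≤ ω / 3 := by nlinarith
    have h5 : Lam ≤ 2 * lam := by linarith
    have h6 : ω ≤ lam / 12 := by linarith
    have h7 : 2 * lam ≤ lam' ^ 2 := by nlinarith
    have h8 : m * ω ≤ m * (lam / 12) := by gcongr
    have h9 : lam ≤ m * lam := by nlinarith
    have h10 : m * (2 * lam) ≤ m * lam' ^ 2 := by gcongr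
    linarith

/-- A sequence growing by a multiple of its square root grows quadratically. -/
theorem sq_mul_le_of_sqrt_growth {S : ℕ → ℝ} {k : ℝ} (hk : 0 ≤ k) (hk1 : k ≤ 1)
    (hS : ∀ t, 1 ≤ S t) (hrec : ∀ t, S t + k * √(S t) ≤ S (t + 1)) (t : ℕ) :
    (k / 3 * t) ^ 2 ≤ S t := by
  induction t with
  | zero => simpa using zero_le_one.trans (hS 0)
  | succ t ih =>
    have h1 := Real.abs_le_sqrt ih
    rw [abs_of_nonneg (by positivity)] at h1
    have h2 : 1 ≤ √(S t) := Real.one_le_sqrt.mpr (hS t)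
    have h3 : √(S t) ^ 2 = S t := Real.sq_sqrt (by linarith [hS t])
    have h4 := hrec t
    push_cast
    have h5 : (k / 3 * (t + 1)) ^ 2 ≤ (√(S t) + k / 3) ^ 2 := by
      gcongr
      linarith
    nlinarith [mul_nonneg hk (sub_nonneg.mpr h2)]

/-- A probe direction built from an estimator in the confidence ellipsoid is close to `θ`. -/
theorem sub_probe_dotProduct_self_le {d : ℕ} {θ y v : Fin d → ℝ} {lam β r : ℝ} (hβ : 2 ≤ β)
    (hlam : 2 ≤ lam) (hθ : θ ⬝ᵥ θ = 1) (hy : y ≠ 0) (hv : v ⬝ᵥ v = 1) (hr : r ^ 2 = lam⁻¹)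
    (hconf : lam * ((θ - y) ⬝ᵥ (θ - y)) ≤ β) :
    lam * ((θ - unitize (unitize y + r • v)) ⬝ᵥ (θ - unitize (unitize y + r • v))) ≤ 6 * β := by
  have hc := unitize_dotProduct_self (dotProduct_self_pos hy)
  have hinv : lam⁻¹ ≤ 1 / 2 := by
    rw [inv_eq_one_div]
    exact one_div_le_one_div_of_le two_pos hlam
  have hr' : r ^ 2 ≤ 1 / 2 := hr.trans_le hinv
  have ha := unitize_dotProduct_self (probe_norm_pos hc hv hr')
  by_cases hs : (θ - y) ⬝ᵥ (θ - y) < 1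
  · have h1 := sub_unitize_dotProduct_self_le hθ hs
    have h2 : (unitize y - (unitize y + r • v)) ⬝ᵥ (unitize y - (unitize y + r • v)) = lam⁻¹ := by
      rw [sub_add_cancel_left, neg_dotProduct_neg, smul_dotProduct, dotProduct_smul, hv, ← hr]
      simp [sq]
    have h3 := sub_unitize_dotProduct_self_le hc (h2.trans_lt (by linarith))
    rw [h2] at h3
    have h4 := sub_dotProduct_self_le_weighted θ (unitize y) (unitize (unitize y + r • v))
    have h5 : lam * lam⁻¹ = 1 := mul_inv_cancel₀ (by linarith)
    generalize unitize (unitize y + r • v) = a at *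
    nlinarith
  · push Not at hs
    have h1 : lam ≤ β := by nlinarith
    have h2 := sq_dotProduct_le θ (unitize (unitize y + r • v))
    rw [sub_dotProduct_self]
    rw [hθ, ha] at h2 ⊢
    have h3 := (abs_le.mp (sq_le_one_iff_abs_le_one _ |>.mp (h2.trans_eq (one_mul 1)))).1
    nlinarith

/-- Deterministic core of the LinUCB-VVN regret analysis: if the unknown unit
vector `θ` lies in every confidence ellipsoid `⟨θ-θ̂_t, V_t(θ-θ̂_t)⟩ ≤ β` along the
weighted design-matrix recursion (with weights `ω(V_t) = √(λ_max V_t)/(12√(d-1)β)`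
and probe directions `a±_{t+1,i}` given by normalizing
`θ̂_t/‖θ̂_t‖ ± v_{t,i}/√(λ_min V_t)` for an ordered orthonormal eigenbasis
`v_{t,1},…,v_{t,d}` of `V_t`), then for every `t ≥ 1` and `i`,
`‖θ − a±_{t+1,i}‖² ≤ (144 d β² + 24 √(d-1) β)/t`. -/
theorem linUCB_VVN_instantaneous_regret
    (d : ℕ) (hd : 2 ≤ d) (β : ℝ) (hβ : 2 ≤ β)
    (lam0 : ℝ)
    (hlam0 : max 2 (Real.sqrt (2 / (3 * ((d : ℝ) - 1))) *
        (2 * (d : ℝ) / (12 * Real.sqrt ((d : ℝ) - 1) * β))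
      + 2 / (3 * ((d : ℝ) - 1))) ≤ lam0)
    (θ : Fin d → ℝ) (hθ : ∑ i, θ i ^ 2 = 1)
    (θhat : ℕ → Fin d → ℝ) (hθhat : ∀ t, θhat t ≠ 0)
    (c : ℕ → Fin d → ℝ) (hc : ∀ t, c t = unitize (θhat t))
    (V : ℕ → Matrix (Fin d) (Fin d) ℝ)
    (μ : ℕ → Fin d → ℝ) (v : ℕ → Fin d → Fin d → ℝ)
    (hmono : ∀ t, Monotone (μ t))
    (horth : ∀ t, ∀ i j : Fin d, ∑ k, v t i k * v t j k = if i = j then 1 else 0)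
    (heig : ∀ t, ∀ i : Fin d, (V t).mulVec (v t i) = μ t i • v t i)
    (ap am : ℕ → Fin (d - 1) → Fin d → ℝ)
    (hap : ∀ t, ∀ i : Fin (d - 1), ap t i =
      unitize (c t + (Real.sqrt (μ t ⟨0, by omega⟩))⁻¹ •
        v t ⟨i.1, i.2.trans_le (Nat.sub_le d 1)⟩))
    (ham : ∀ t, ∀ i : Fin (d - 1), am t i =
      unitize (c t - (Real.sqrt (μ t ⟨0, by omega⟩))⁻¹ •
        v t ⟨i.1, i.2.trans_le (Nat.sub_le d 1)⟩))
    (hV0 : V 0 = lam0 • (1 : Matrix (Fin d) (Fin d) ℝ))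
    (hVrec : ∀ t, V (t + 1) = V t +
      (Real.sqrt (μ t ⟨d - 1, by omega⟩) / (12 * Real.sqrt ((d : ℝ) - 1) * β)) •
        ∑ i : Fin (d - 1), (vecMulVec (ap t i) (ap t i) + vecMulVec (am t i) (am t i)))
    (hconf : ∀ t, (θ - θhat t) ⬝ᵥ (V t).mulVec (θ - θhat t) ≤ β) :
    ∀ t : ℕ, 1 ≤ t → ∀ i : Fin (d - 1),
      (∑ j, (θ j - ap t i j) ^ 2
          ≤ (144 * (d : ℝ) * β ^ 2 + 24 * Real.sqrt ((d : ℝ) - 1) * β) / (t : ℝ)) ∧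
      (∑ j, (θ j - am t i j) ^ 2
          ≤ (144 * (d : ℝ) * β ^ 2 + 24 * Real.sqrt ((d : ℝ) - 1) * β) / (t : ℝ)) := by
  have hβ0 : 0 < β := by linarith
  have hpos : 0 < d := by omega
  have hlast : d - 1 < d := by omega
  have hlt : ∀ i : Fin (d - 1), i.1 < d := fun i => i.2.trans_le (Nat.sub_le d 1)
  have hd1 : (1 : ℝ) ≤ (d : ℝ) - 1 := by
    have : (2 : ℝ) ≤ d := by exact_mod_cast hd
    linarith
  have hd0 : (0 : ℝ) < d := by linarith
  have hcard : ((Fintype.card (Fin (d - 1)) : ℕ) : ℝ) = (d : ℝ) - 1 := by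
    rw [Fintype.card_fin, Nat.cast_sub (by omega), Nat.cast_one]
  have hlam02 : 2 ≤ lam0 := (le_max_left _ _).trans hlam0
  have hθ' : θ ⬝ᵥ θ = 1 := by simpa only [dotProduct, sq] using hθ
  have hcc : ∀ t, c t ⬝ᵥ c t = 1 := fun t => by
    rw [hc]; exact unitize_dotProduct_self (dotProduct_self_pos (hθhat t))
  have hvv : ∀ t i, v t i ⬝ᵥ v t i = 1 := fun t i => by simpa [dotProduct] using horth t i i
  have hminmax : ∀ t, μ t ⟨0, by omega⟩ ≤ μ t ⟨d - 1, by omega⟩ := fun t =>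
    hmono t (Fin.mk_le_of_le_val (Nat.zero_le _))
  set m : ℝ := (d : ℝ) - 1 with hm
  have hsm : 1 ≤ √m := Real.one_le_sqrt.mpr hd1
  have hr : ∀ t, 2 ≤ μ t ⟨0, by omega⟩ →
      (√(μ t ⟨0, by omega⟩))⁻¹ ^ 2 = (μ t ⟨0, by omega⟩)⁻¹ := fun t h => by
    rw [inv_pow, Real.sq_sqrt (by linarith)]
  have hr' : ∀ t, 2 ≤ μ t ⟨0, by omega⟩ → (√(μ t ⟨0, by omega⟩))⁻¹ ^ 2 ≤ 1 / 2 := fun t h => by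
    rw [hr t h, inv_eq_one_div]
    exact one_div_le_one_div_of_le two_pos h
  have hap1 : ∀ t, 2 ≤ μ t ⟨0, by omega⟩ → ∀ i, ap t i ⬝ᵥ ap t i = 1 := fun t h i => by
    rw [hap]
    exact unitize_dotProduct_self (probe_norm_pos (hcc t) (hvv t _) (hr' t h))
  have ham1 : ∀ t, 2 ≤ μ t ⟨0, by omega⟩ → ∀ i, am t i ⬝ᵥ am t i = 1 := fun t h i => by
    rw [ham, sub_eq_add_neg, ← neg_smul]
    exact unitize_dotProduct_self
      (probe_norm_pos (hcc t) (hvv t _) (by rw [neg_sq]; exact hr' t h))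
  have hinv : ∀ t, 2 ≤ μ t ⟨0, by omega⟩ ∧
      2 * μ t ⟨d - 1, by omega⟩ ≤ 3 * m * μ t ⟨0, by omega⟩ ^ 2 := by
    intro t
    induction t with
    | zero =>
      have hμ0 : ∀ i, μ 0 i = lam0 := fun i => by
        rw [eigenvalue_eq_dotProduct (horth 0) (heig 0) i, hV0, Matrix.smul_mulVec,
          Matrix.one_mulVec, dotProduct_smul, hvv, smul_eq_mul, mul_one]
      rw [hμ0, hμ0]
      exact ⟨hlam02, by nlinarith⟩
    | succ t ih =>
      obtain ⟨h2, hbal⟩ := ih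
      have hω0 : 0 ≤ √(μ t ⟨d - 1, by omega⟩) / (12 * √m * β) := by positivity
      have hω1 : √(μ t ⟨d - 1, by omega⟩) / (12 * √m * β) ≤ μ t ⟨d - 1, by omega⟩ / 24 := by
        have hL : 1 ≤ μ t ⟨d - 1, by omega⟩ := by linarith [hminmax t]
        have h24 : 24 ≤ 12 * √m * β := by nlinarith
        have : √(μ t ⟨d - 1, by omega⟩) ≤ μ t ⟨d - 1, by omega⟩ :=
          Real.sqrt_le_iff.mpr ⟨by linarith, by nlinarith⟩
        gcongr
      have hsplit : ∑ i : Fin (d - 1),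
          (v (t + 1) ⟨0, by omega⟩ ⬝ᵥ v t ⟨i.1, i.2.trans_le (Nat.sub_le d 1)⟩) ^ 2 =
          1 - (v (t + 1) ⟨0, by omega⟩ ⬝ᵥ v t ⟨d - 1, by omega⟩) ^ 2 := by
        have := dotProduct_self_eq_sum_sq (horth t) (v (t + 1) ⟨0, by omega⟩)
        rw [hvv, sum_fin_sub_one_add_last hlast hlt] at this
        linarith
      refine eigenvalue_balance_step
        (s := (v (t + 1) ⟨0, by omega⟩ ⬝ᵥ v t ⟨d - 1, by omega⟩) ^ 2)
        hd1 h2 (hminmax t) hω0 hω1 (sq_nonneg _) ?_ ?_ ?_ hbal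
      · have := sq_dotProduct_le (v (t + 1) ⟨0, by omega⟩) (v t ⟨d - 1, by omega⟩)
        rwa [hvv, hvv, one_mul] at this
      · rw [eigenvalue_eq_dotProduct (horth (t + 1)) (heig (t + 1)) ⟨0, by omega⟩,
          dotProduct_rankOne_update (hVrec t)]
        have h3 := min_max_eigenvalue_le (horth t) (heig t) (hmono t) hpos hlast hlt
          (v (t + 1) ⟨0, by omega⟩)
        rw [hsplit] at h3
        refine add_le_add h3 (mul_le_mul_of_nonneg_left ?_ hω0)
        rw [← hsplit, Finset.mul_sum]
        refine Finset.sum_le_sum fun i _ => ?_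
        rw [hap, ham, ← hr t h2]
        exact sum_sq_dotProduct_probe_ge (hcc t) (hvv t _) (hr' t h2) _
      · rw [eigenvalue_eq_dotProduct (horth (t + 1)) (heig (t + 1)) ⟨d - 1, by omega⟩,
          dotProduct_rankOne_update (hVrec t)]
        have h3 := le_max_eigenvalue_mul (horth t) (heig t) (hmono t) hlast
          (v (t + 1) ⟨d - 1, by omega⟩)
        rw [hvv, mul_one] at h3
        rw [mul_comm (2 * m)]
        refine add_le_add h3 (mul_le_mul_of_nonneg_left ?_ hω0)
        have h4 : ∀ i : Fin (d - 1), (v (t + 1) ⟨d - 1, by omega⟩ ⬝ᵥ ap t i) ^ 2 +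
            (v (t + 1) ⟨d - 1, by omega⟩ ⬝ᵥ am t i) ^ 2 ≤ 2 := fun i => by
          have h5 := sq_dotProduct_le (v (t + 1) ⟨d - 1, by omega⟩) (ap t i)
          have h6 := sq_dotProduct_le (v (t + 1) ⟨d - 1, by omega⟩) (am t i)
          rw [hvv, hap1 t h2] at h5
          rw [hvv, ham1 t h2] at h6
          linarith
        refine (Finset.sum_le_sum fun i _ => h4 i).trans_eq ?_
        rw [Finset.sum_const, Finset.card_univ, nsmul_eq_mul, hcard, mul_comm]
  have htr : ∀ t, (V t).trace = ∑ i, μ t i := fun t => trace_eq_sum_eigenvalues (horth t) (heig t)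
  have htr_le : ∀ t, (V t).trace ≤ d * μ t ⟨d - 1, by omega⟩ := fun t => by
    rw [htr]
    refine (Finset.sum_le_card_nsmul _ _ (μ t ⟨d - 1, by omega⟩) fun i _ => hmono t ?_).trans_eq ?_
    · exact Fin.le_def.mpr (by have := i.2; simp only; omega)
    · simp
  have htr_ge : ∀ t, 1 ≤ (V t).trace := fun t => by
    have h := Finset.card_nsmul_le_sum Finset.univ (μ t) 2
      fun i _ => (hinv t).1.trans (hmono t (Fin.mk_le_of_le_val (Nat.zero_le _)))
    rw [htr]
    simp only [Finset.card_univ, Fintype.card_fin, nsmul_eq_mul] at h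
    linarith
  obtain ⟨k, hk⟩ : ∃ k, k = √m / (6 * β * √d) := ⟨_, rfl⟩
  have hsd : 0 < √(d : ℝ) := Real.sqrt_pos.mpr hd0
  have hk0 : 0 ≤ k := by rw [hk]; positivity
  have hk1 : k ≤ 1 := by
    rw [hk, div_le_one (by positivity)]
    have : √m ≤ √(d : ℝ) := Real.sqrt_le_sqrt (by linarith)
    nlinarith
  have hgrow := sq_mul_le_of_sqrt_growth (S := fun t => (V t).trace) hk0 hk1 htr_ge fun t => by
    rw [trace_rankOne_update (hVrec t) (hap1 t (hinv t).1) (ham1 t (hinv t).1), hcard]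
    have h1 : √(V t).trace ≤ √d * √(μ t ⟨d - 1, by omega⟩) := by
      rw [← Real.sqrt_mul hd0.le]
      exact Real.sqrt_le_sqrt (htr_le t)
    have h2 : 2 * m * (√(μ t ⟨d - 1, by omega⟩) / (12 * √m * β)) =
        k * (√d * √(μ t ⟨d - 1, by omega⟩)) := by
      have h3 : √m ^ 2 = m := Real.sq_sqrt (by linarith)
      rw [hk]
      nth_rewrite 1 [← h3]
      field_simp
      ring
    rw [h2]
    gcongr
  have hmin : ∀ t : ℕ, (t : ℝ) ≤ 24 * d * β * μ t ⟨0, by omega⟩ := fun t => by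
    have h1 := hgrow t
    have h2 := htr_le t
    have h3 := (hinv t).2
    have h4 := (hinv t).1
    have hk2 : k ^ 2 * (36 * β ^ 2 * d) = m := by
      rw [hk, div_pow, mul_pow, Real.sq_sqrt (by linarith), Real.sq_sqrt hd0.le]
      field_simp
      ring
    have h5 : (k / 3 * t) ^ 2 ≤ d * (3 * m * μ t ⟨0, by omega⟩ ^ 2 / 2) :=
      h1.trans (h2.trans (by gcongr; linarith))
    have h6 : m * (t : ℝ) ^ 2 ≤ m * (486 * d ^ 2 * β ^ 2 * μ t ⟨0, by omega⟩ ^ 2) := by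
      calc m * (t : ℝ) ^ 2 = (k / 3 * t) ^ 2 * (324 * β ^ 2 * d) := by rw [← hk2]; ring
        _ ≤ d * (3 * m * μ t ⟨0, by omega⟩ ^ 2 / 2) * (324 * β ^ 2 * d) := by gcongr
        _ = _ := by ring
    have h7 := le_of_mul_le_mul_left h6 (by linarith)
    refine abs_le_of_sq_le_sq' ?_ (by positivity) |>.2
    nlinarith [sq_nonneg (d * β * μ t ⟨0, by omega⟩)]
  have hfinal : ∀ t : ℕ, 1 ≤ t → ∀ a : Fin d → ℝ,
      μ t ⟨0, by omega⟩ * ((θ - a) ⬝ᵥ (θ - a)) ≤ 6 * β →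
      ∑ j, (θ j - a j) ^ 2 ≤ (144 * (d : ℝ) * β ^ 2 + 24 * √m * β) / (t : ℝ) := by
    intro t ht a ha
    have ht0 : (0 : ℝ) < t := by exact_mod_cast ht
    have hsum : ∑ j, (θ j - a j) ^ 2 = (θ - a) ⬝ᵥ (θ - a) := by
      simp only [dotProduct, Pi.sub_apply, sq]
    rw [hsum, le_div_iff₀ ht0]
    have h0 := zero_le_dotProduct_self (θ - a)
    calc (θ - a) ⬝ᵥ (θ - a) * t ≤
        (θ - a) ⬝ᵥ (θ - a) * (24 * d * β * μ t ⟨0, by omega⟩) := by gcongr; exact hmin t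
      _ = 24 * d * β * (μ t ⟨0, by omega⟩ * ((θ - a) ⬝ᵥ (θ - a))) := by ring
      _ ≤ 24 * d * β * (6 * β) := by gcongr
      _ ≤ _ := by
        have : 0 ≤ 24 * √m * β := by positivity
        linarith
  intro t ht i
  have h2 := (hinv t).1
  have hball := (min_eigenvalue_mul_le (horth t) (heig t) (hmono t) hpos _).trans (hconf t)
  constructor
  · refine hfinal t ht _ ?_
    rw [hap, hc]
    exact sub_probe_dotProduct_self_le hβ h2 hθ' (hθhat t) (hvv t _) (hr t h2) hball
  · refine hfinal t ht _ ?_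
    rw [ham, hc, sub_eq_add_neg (unitize _), ← neg_smul]
    exact sub_probe_dotProduct_self_le hβ h2 hθ' (hθhat t) (hvv t _)
      (by rw [neg_sq]; exact hr t h2) hball
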